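/- The map Φ : P_MC(𝒮) → 𝒟 sending each staircase Markov chain to its sequence of one-dimensional marginal distributions is a homeomorphism (a continuous bijection with continuous inverse). Moreover the inverse is given explicitly: for {ν_N}_{N∈ℕ} ∈ 𝒟, the unique μ ∈ P_MC(𝒮) with Φ(μ) = {ν_N} is the law of the inhomogeneous Markov chain with μ(S_0 = 0) = 1 and, for every N ∈ ℕ and every s ∈ {0,…,N} with ν_N(s) > 0, μ(S_{N+1} = s | S_N = s) = ν_{N+1}(s)/ν_N(s) and μ(S_{N+1} = N+1 | S_N = s) = 1 − ν_{N+1}(s)/ν_N(s). -/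

import Mathlib

open MeasureTheory Filter
open scoped ENNReal NNReal

namespace VMCPaper

abbrev Path : Type := ℕ → ℕ

def staircaseSet : Set Path :=
  {S | (∀ N, S N ≤ N) ∧ ∀ N, S (N + 1) = S N ∨ S (N + 1) = N + 1}

noncomputable def pr {α : Type*} [MeasurableSpace α] (μ : Measure α) (A : Set α) : ℝ :=
  (μ A).toReal

def IsSMC (μ : Measure Path) : Prop :=
  IsProbabilityMeasure μ ∧ μ staircaseSet = 1 ∧
  ∀ (N : ℕ) (a : ℕ → ℕ),
    0 < pr μ {S | ∀ i ≤ N, S i = a i} →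
    pr μ {S | (∀ i ≤ N, S i = a i) ∧ S (N + 1) = a (N + 1)} /
        pr μ {S | ∀ i ≤ N, S i = a i}
      = pr μ {S | S N = a N ∧ S (N + 1) = a (N + 1)} / pr μ {S | S N = a N}

noncomputable def marginals (μ : Measure Path) : ℕ → ℕ → ℝ :=
  fun N a => pr μ {S | S N = a}

def D : Set (ℕ → ℕ → ℝ) :=
  {ν | (∀ N a, 0 ≤ ν N a) ∧ (∀ N a, N < a → ν N a = 0) ∧
       (∀ N, ∑ a ∈ Finset.range (N + 1), ν N a = 1) ∧
       ∀ N a, a ≤ N → ν (N + 1) a ≤ ν N a}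

def PMC : Set (ProbabilityMeasure Path) := {μ | IsSMC (μ : Measure Path)}

def IsBalayage (π : ℕ → ℕ → ℝ) : Prop :=
  (∀ N a, 0 ≤ π N a) ∧ (∀ N a, N < a → π N a = 0) ∧
  ∀ N, ∑ a ∈ Finset.range (N + 1), π N a = 1

def Dpi (π : ℕ → ℕ → ℝ) : Set (ℕ → ℕ → ℝ) :=
  {ν | ν ∈ D ∧ ∀ N a, a ≤ N → ν N a = ν (N + 1) a + ν (N + 1) (N + 1) * π N a}

def PMCpi (π : ℕ → ℕ → ℝ) : Set (Measure Path) :=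
  {μ | IsSMC μ ∧ ∀ N a, a ≤ N →
    0 < pr μ {S | S (N + 1) = N + 1} →
    pr μ {S | S N = a ∧ S (N + 1) = N + 1} / pr μ {S | S (N + 1) = N + 1} = π N a}

def pathTail : MeasurableSpace Path :=
  ⨅ N : ℕ, MeasurableSpace.comap (fun (S : Path) (i : ℕ) => S (N + i)) inferInstance

def HasTrivialTail (μ : Measure Path) : Prop :=
  ∀ A : Set Path, MeasurableSet[pathTail] A → μ A = 0 ∨ μ A = 1

def AffineOn {E : Type*} [AddCommMonoid E] [Module ℝ E] (f : E → ℝ) (K : Set E) : Prop :=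
  ∀ x ∈ K, ∀ y ∈ K, ∀ t : ℝ, 0 ≤ t → t ≤ 1 →
    f (t • x + (1 - t) • y) = t * f x + (1 - t) * f y

def RepresentsOn {E : Type*} [AddCommMonoid E] [Module ℝ E] [TopologicalSpace E]
    [MeasurableSpace E] (m : Measure E) (K : Set E) (x : E) : Prop :=
  ∀ f : E → ℝ, ContinuousOn f K → AffineOn f K → f x = ∫ y, f y ∂m

def IsChoquetSimplex {E : Type*} [AddCommMonoid E] [Module ℝ E] [TopologicalSpace E]
    [MeasurableSpace E] (K : Set E) : Prop :=
  ∀ x ∈ K, ∃! m : Measure E,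
    IsProbabilityMeasure m ∧ m (Set.extremePoints ℝ K) = 1 ∧ RepresentsOn m K x

noncomputable def hitTime (x : Path) (A : Set ℕ) : ℕ → ℕ∞
  | 0 => ⨅ i ∈ {i : ℕ | x i ∈ A}, (i : ℕ∞)
  | k + 1 => ⨅ i ∈ {i : ℕ | hitTime x A k < (i : ℕ∞) ∧ x i ∈ A}, (i : ℕ∞)

noncomputable def proj (N : ℕ) (x : Path) : Path := fun i =>
  if hitTime x {a | a ≤ N} i = ⊤ then 0 else x (hitTime x {a | a ≤ N} i).toNat

def pathSpace (N : ℕ) : Set Path :=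
  {x | (∀ i, x i ≤ N) ∧ ∀ i, x i = 0 → ∀ j, i ≤ j → x j = 0}

def fullPathSpace : Set Path := {x | ∀ i, x i = 0 → ∀ j, i ≤ j → x j = 0}

def IsMarkovChain {Ω : Type*} [MeasurableSpace Ω] (P : Measure Ω) (Y : ℕ → Ω → ℕ) : Prop :=
  (∀ i, Measurable (Y i)) ∧
  (∀ (n : ℕ) (b : ℕ → ℕ),
    0 < (P {ω | ∀ i ≤ n, Y i ω = b i}).toReal →
    (P {ω | (∀ i ≤ n, Y i ω = b i) ∧ Y (n + 1) ω = b (n + 1)}).toReal /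
        (P {ω | ∀ i ≤ n, Y i ω = b i}).toReal
      = (P {ω | Y n ω = b n ∧ Y (n + 1) ω = b (n + 1)}).toReal /
        (P {ω | Y n ω = b n}).toReal) ∧
  (∀ m n b c : ℕ,
    0 < (P {ω | Y m ω = b}).toReal → 0 < (P {ω | Y n ω = b}).toReal →
    (P {ω | Y m ω = b ∧ Y (m + 1) ω = c}).toReal / (P {ω | Y m ω = b}).toReal
      = (P {ω | Y n ω = b ∧ Y (n + 1) ω = c}).toReal / (P {ω | Y n ω = b}).toReal)

def IsVMC {Ω : Type*} [MeasurableSpace Ω] (P : Measure Ω) (X : Ω → ℕ → Path) : Prop :=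
  IsProbabilityMeasure P ∧
  Measurable X ∧
  (∀ ω N, X ω N ∈ pathSpace N) ∧
  (∀ ω N, proj N (X ω (N + 1)) = X ω N) ∧
  ∀ N, IsMarkovChain P (fun i ω => X ω N i)

def S0 {Ω : Type*} (X : Ω → ℕ → Path) (N : ℕ) (ω : Ω) : ℕ := X ω N 0

noncomputable def Vis {Ω : Type*} (X : Ω → ℕ → Path) (a : ℕ) (ω : Ω) : ℕ∞ :=
  {k : ℕ | hitTime (X ω a) {a} k ≠ ⊤}.encard

open scoped Classical in
noncomputable def Sak {Ω : Type*} (X : Ω → ℕ → Path) (a k N : ℕ) (ω : Ω) : ℕ :=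
  if (k : ℕ∞) < Vis X a ω ∧ hitTime (X ω N) {a} k ≠ ⊤ then
    X ω N ((hitTime (X ω N) {a} k).toNat + 1)
  else 0

def InfinitelyVisited {Ω : Type*} [MeasurableSpace Ω] (P : Measure Ω)
    (X : Ω → ℕ → Path) (a : ℕ) : Prop := P {ω | Vis X a ω = ⊤} = 1

def OnceVisited {Ω : Type*} [MeasurableSpace Ω] (P : Measure Ω)
    (X : Ω → ℕ → Path) (a : ℕ) : Prop := P {ω | Vis X a ω = 1} = 1

def NeverVisited {Ω : Type*} [MeasurableSpace Ω] (P : Measure Ω)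
    (X : Ω → ℕ → Path) (a : ℕ) : Prop := P {ω | Vis X a ω = 0} = 1

def RandomlyVisited {Ω : Type*} [MeasurableSpace Ω] (P : Measure Ω)
    (X : Ω → ℕ → Path) (a : ℕ) : Prop :=
  ¬ InfinitelyVisited P X a ∧ ¬ OnceVisited P X a ∧ ¬ NeverVisited P X a

def sigmaX {Ω : Type*} (X : Ω → ℕ → Path) : MeasurableSpace Ω :=
  MeasurableSpace.comap X inferInstance

def tailVMC {Ω : Type*} (X : Ω → ℕ → Path) : MeasurableSpace Ω :=
  ⨅ N : ℕ, MeasurableSpace.comap (fun ω (M : ℕ) => X ω (N + M)) inferInstance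

def TailTrivial {Ω : Type*} [MeasurableSpace Ω] (P : Measure Ω) (X : Ω → ℕ → Path) : Prop :=
  ∀ A : Set Ω, MeasurableSet[tailVMC X] A → P A = 0 ∨ P A = 1

def RepresentedBy {Ω : Type*} [MeasurableSpace Ω] (P : Measure Ω) (X : Ω → ℕ → Path)
    (ν : ℕ → ℕ → ℝ) (K : ℕ → ℕ → ℕ → ℝ) : Prop :=
  (∀ N a, a ≤ N → (P {ω | X ω N 0 = a}).toReal = ν N a) ∧
  ∀ N a b, a ≤ N → b ≤ N → 0 < (P {ω | X ω N 0 = a}).toReal →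
    (P {ω | X ω N 0 = a ∧ X ω N 1 = b}).toReal / (P {ω | X ω N 0 = a}).toReal = K N a b

noncomputable def piK (K : ℕ → ℕ → ℕ → ℝ) (N : ℕ) (b : ℕ) : ℝ :=
  if K (N + 1) (N + 1) (N + 1) < 1 then
    K (N + 1) (N + 1) b / (1 - K (N + 1) (N + 1) (N + 1))
  else if b = 0 then 1 else 0

def IsVTM (K : ℕ → ℕ → ℕ → ℝ) : Prop :=
  (∀ N a b, 0 ≤ K N a b) ∧
  (∀ N a b, a ≤ N → N < b → K N a b = 0) ∧
  (∀ N a, a ≤ N → ∑ b ∈ Finset.range (N + 1), K N a b = 1) ∧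
  (∀ N, K N 0 0 = 1) ∧
  (∀ N a b, a ≤ N → b ≤ N → K N a b = K (N + 1) a b + K (N + 1) a (N + 1) * piK K N b)

def mpow (N : ℕ) (M : ℕ → ℕ → ℝ) : ℕ → ℕ → ℕ → ℝ
  | 0 => fun a b => if a = b then 1 else 0
  | n + 1 => fun a b => ∑ c ∈ Finset.range (N + 1), mpow N M n a c * M c b

def IsIrreducibleVTM (K : ℕ → ℕ → ℕ → ℝ) : Prop :=
  ∀ N, 1 ≤ N → ∀ a b, 1 ≤ a → a ≤ N → 1 ≤ b → b ≤ N →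
    ∃ n, 0 < mpow N (K N) n a b

def IsClassical {Ω : Type*} [MeasurableSpace Ω] (P : Measure Ω) (X : Ω → ℕ → Path) : Prop :=
  ∀ᵐ ω ∂P, ∃ x : Path, x ∈ fullPathSpace ∧
    (∀ i, ∀ᶠ N in atTop, X ω N i = x i) ∧ ∀ N, X ω N = proj N x


lemma clopen_eq (N a : ℕ) : IsClopen {S : Path | S N = a} :=
  (isClopen_discrete ({a} : Set ℕ)).preimage (continuous_apply N)

lemma clopen_pair (N s t : ℕ) : IsClopen {S : Path | S N = s ∧ S (N + 1) = t} :=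
  (clopen_eq N s).inter (clopen_eq (N + 1) t)

lemma clopen_cyl (N : ℕ) (a : ℕ → ℕ) : IsClopen {S : Path | ∀ i ≤ N, S i = a i} := by
  have h : {S : Path | ∀ i ≤ N, S i = a i} = ⋂ i ∈ Finset.range (N + 1), {S : Path | S i = a i} := by
    ext S
    simp
  rw [h]
  exact isClopen_biInter_finset fun i _ => clopen_eq i (a i)

lemma clopen_cyl' (N : ℕ) (a : ℕ → ℕ) :
    IsClopen {S : Path | (∀ i ≤ N, S i = a i) ∧ S (N + 1) = a (N + 1)} :=
  (clopen_cyl N a).inter (clopen_eq _ _)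

lemma cyl_succ (N : ℕ) (a : ℕ → ℕ) :
    {S : Path | ∀ i ≤ N + 1, S i = a i}
      = {S : Path | (∀ i ≤ N, S i = a i) ∧ S (N + 1) = a (N + 1)} := by
  ext S
  constructor
  · intro h
    exact ⟨fun i hi => h i (by omega), h _ le_rfl⟩
  · rintro ⟨h1, h2⟩ i hi
    rcases Nat.lt_or_ge N i with h | h
    · obtain rfl : i = N + 1 := by omega
      exact h2
    · exact h1 i h

lemma continuous_pr {A : Set Path} (hA : IsClopen A) :
    Continuous fun μ : ProbabilityMeasure Path => pr (μ : Measure Path) A := by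
  rw [continuous_iff_continuousAt]
  intro μ
  have h := ProbabilityMeasure.tendsto_measure_of_isClopen_of_tendsto
    (μs := fun x : ProbabilityMeasure Path => x) (L := nhds μ) (μ := μ) tendsto_id hA
  exact (NNReal.continuous_coe.tendsto _).comp h

lemma compact_stair : IsCompact staircaseSet := by
  have h1 : IsCompact (Set.pi Set.univ fun N : ℕ => Set.Iic N : Set Path) :=
    isCompact_univ_pi (X := fun _ : ℕ => ℕ) fun N => (Set.finite_Iic N).isCompact
  refine h1.of_isClosed_subset ?_ ?_
  · have : staircaseSet = ⋂ N : ℕ, ({S : Path | S N ≤ N} ∩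
        {S : Path | S (N + 1) = S N ∨ S (N + 1) = N + 1}) := by
      ext S
      simp [staircaseSet, forall_and]
    rw [this]
    refine isClosed_iInter fun N => IsClosed.inter ?_ ?_
    · exact isClosed_le (continuous_apply N) continuous_const
    · exact (isClosed_eq (f := fun S : Path => S (N + 1)) (g := fun S : Path => S N)
        (continuous_apply _) (continuous_apply _)).union
        (isClosed_eq (f := fun S : Path => S (N + 1)) (continuous_apply _) continuous_const)
  · intro S hS N _
    exact hS.1 N

lemma ae_stair {μ : Measure Path} [IsProbabilityMeasure μ] (h : μ staircaseSet = 1) :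
    ∀ᵐ S ∂μ, S ∈ staircaseSet :=
  (mem_ae_iff_prob_eq_one compact_stair.measurableSet).2 h

lemma pr_congr {μ : Measure Path} {A B : Set Path} (h : ∀ᵐ S ∂μ, (S ∈ A ↔ S ∈ B)) :
    pr μ A = pr μ B := by
  unfold pr
  rw [measure_congr]
  filter_upwards [h] with S hS
  exact propext hS

lemma pr_zero {μ : Measure Path} {A : Set Path} (h : ∀ᵐ S ∂μ, S ∉ A) : pr μ A = 0 := by
  unfold pr
  rw [measure_eq_zero_iff_ae_notMem.2 h]
  rfl

lemma pr_mono {μ : Measure Path} [IsProbabilityMeasure μ] {A B : Set Path} (h : A ⊆ B) :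
    pr μ A ≤ pr μ B := measureReal_mono h

lemma pr_nonneg (μ : Measure Path) (A : Set Path) : 0 ≤ pr μ A := ENNReal.toReal_nonneg

noncomputable def pairF (ν : ℕ → ℕ → ℝ) (N s t : ℕ) : ℝ :=
  if s ≤ N then (if t = s then ν (N + 1) s else if t = N + 1 then ν N s - ν (N + 1) s else 0)
  else 0

lemma pair_eq {μ : Measure Path} [IsProbabilityMeasure μ] (h : ∀ᵐ S ∂μ, S ∈ staircaseSet)
    (N s t : ℕ) : pr μ {S | S N = s ∧ S (N + 1) = t} = pairF (marginals μ) N s t := by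
  have hstay : ∀ s ≤ N, pr μ {S | S N = s ∧ S (N + 1) = s} = pr μ {S | S (N + 1) = s} := by
    intro s hs
    apply pr_congr
    filter_upwards [h] with S hS
    have h2 := hS.2 N
    try simp only [Set.mem_ofPred_eq]
    omega
  unfold pairF marginals
  split_ifs with h1 h2 h3
  · subst h2
    exact hstay t h1
  · subst h3
    rw [← hstay s h1]
    have : pr μ {S | S N = s} =
        pr μ ({S | S N = s ∧ S (N + 1) = s} ∪ {S | S N = s ∧ S (N + 1) = N + 1}) := by
      apply pr_congr
      filter_upwards [h] with S hS
      have h2 := hS.2 N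
      simp only [Set.mem_ofPred_eq, Set.mem_union]
      omega
    rw [this]
    have h5 : pr μ ({S | S N = s ∧ S (N + 1) = s} ∪ {S | S N = s ∧ S (N + 1) = N + 1}) = _ :=
      measureReal_union (μ := μ) ?_ (clopen_pair N s (N + 1)).isOpen.measurableSet
    · rw [h5]
      simp [pr, Measure.real]
    · rw [Set.disjoint_left]
      intro S hS hS'
      simp only [Set.mem_ofPred_eq] at hS hS'
      omega
  · apply pr_zero
    filter_upwards [h] with S hS
    have h2 := hS.2 N
    try simp only [Set.mem_ofPred_eq]
    omega
  · apply pr_zero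
    filter_upwards [h] with S hS
    have h2 := hS.1 N
    try simp only [Set.mem_ofPred_eq]
    omega

lemma sum_marg {μ : Measure Path} [IsProbabilityMeasure μ] (h : ∀ᵐ S ∂μ, S ∈ staircaseSet)
    (N : ℕ) : ∑ a ∈ Finset.range (N + 1), marginals μ N a = 1 := by
  have h1 : pr μ (⋃ a ∈ Finset.range (N + 1), {S : Path | S N = a}) = _ :=
    measureReal_biUnion_finset (μ := μ) (s := Finset.range (N + 1))
      (f := fun a => {S : Path | S N = a}) ?_ ?_
  · have h2 : pr μ (⋃ a ∈ Finset.range (N + 1), {S : Path | S N = a}) = pr μ Set.univ := by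
      apply pr_congr
      filter_upwards [h] with S hS
      have := hS.1 N
      simpa using Nat.lt_succ_of_le this
    have h3 : pr μ Set.univ = 1 := by simp [pr]
    rw [h2, h3] at h1
    exact h1.symm
  · intro a _ b _ hab
    rw [Function.onFun, Set.disjoint_left]
    intro S hS hS'
    exact hab (hS.symm.trans hS')
  · intro a _
    exact (clopen_eq N a).isOpen.measurableSet

lemma marg_zero {μ : Measure Path} (h : ∀ᵐ S ∂μ, S ∈ staircaseSet)
    (N a : ℕ) (ha : N < a) : marginals μ N a = 0 := by
  apply pr_zero
  filter_upwards [h] with S hS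
  have h2 := hS.1 N
  try simp only [Set.mem_ofPred_eq]
  omega

lemma marg_mem {μ : Measure Path} [IsProbabilityMeasure μ] (h : ∀ᵐ S ∂μ, S ∈ staircaseSet) :
    marginals μ ∈ D := by
  refine ⟨fun N a => pr_nonneg _ _, marg_zero h, sum_marg h, fun N a ha => ?_⟩
  have h1 := pair_eq h N a a
  simp only [pairF, ha, if_true] at h1
  rw [← h1]
  exact pr_mono fun S hS => hS.1

lemma smc_cross {μ : Measure Path} : IsSMC μ ↔ IsProbabilityMeasure μ ∧ μ staircaseSet = 1 ∧
    ∀ (N : ℕ) (a : ℕ → ℕ),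
    pr μ {S | (∀ i ≤ N, S i = a i) ∧ S (N + 1) = a (N + 1)} * pr μ {S | S N = a N}
      = pr μ {S | S N = a N ∧ S (N + 1) = a (N + 1)} * pr μ {S | ∀ i ≤ N, S i = a i} := by
  unfold IsSMC
  refine and_congr_right fun hp => and_congr_right fun _ => forall_congr' fun N =>
    forall_congr' fun a => ?_
  have hle : pr μ {S | ∀ i ≤ N, S i = a i} ≤ pr μ {S | S N = a N} :=
    pr_mono fun S hS => hS N le_rfl
  have hle2 : pr μ {S | (∀ i ≤ N, S i = a i) ∧ S (N + 1) = a (N + 1)}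
      ≤ pr μ {S | ∀ i ≤ N, S i = a i} := pr_mono fun S hS => hS.1
  have h0 := pr_nonneg μ {S | (∀ i ≤ N, S i = a i) ∧ S (N + 1) = a (N + 1)}
  have h1 := pr_nonneg μ {S | ∀ i ≤ N, S i = a i}
  rcases h1.eq_or_lt with h2 | h2
  · have : pr μ {S | (∀ i ≤ N, S i = a i) ∧ S (N + 1) = a (N + 1)} = 0 := by linarith
    simp [← h2, this]
  · have h3 : 0 < pr μ {S | S N = a N} := by linarith
    simp only [h2, true_imp_iff]
    rw [div_eq_div_iff h2.ne' h3.ne']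

lemma cyl_eq {μ μ' : Measure Path} (hμ : IsSMC μ) (hμ' : IsSMC μ')
    (h : marginals μ = marginals μ') (a : ℕ → ℕ) (N : ℕ) :
    pr μ {S | ∀ i ≤ N, S i = a i} = pr μ' {S | ∀ i ≤ N, S i = a i} := by
  have := hμ.1
  have := hμ'.1
  have hs := ae_stair hμ.2.1
  have hs' := ae_stair hμ'.2.1
  induction N with
  | zero =>
    have := congrFun (congrFun h 0) (a 0)
    simpa [marginals] using this
  | succ N ih =>
    have h1 := (smc_cross.1 hμ).2.2 N a
    have h2 := (smc_cross.1 hμ').2.2 N a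
    rw [pair_eq hs, ih] at h1
    rw [pair_eq hs', ← h, ← h1] at h2
    have h3 : pr μ {S | S N = a N} = pr μ' {S | S N = a N} := congrFun (congrFun h N) (a N)
    rw [cyl_succ]
    rcases eq_or_ne (pr μ {S | S N = a N}) 0 with h4 | h4
    · have h5 : ∀ m : Measure Path, IsProbabilityMeasure m → pr m {S | S N = a N} = 0 →
          pr m {S | (∀ i ≤ N, S i = a i) ∧ S (N + 1) = a (N + 1)} = 0 := by
        intro m hm h0
        refine le_antisymm ?_ (pr_nonneg _ _)
        rw [← h0]
        exact pr_mono fun S hS => hS.1 N le_rfl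
      rw [h5 μ ‹_› h4, h5 μ' ‹_› (h3 ▸ h4)]
    · rw [← h3] at h2
      exact (mul_right_cancel₀ h4 h2).symm

lemma smc_ext {μ μ' : Measure Path} (hμ : IsSMC μ) (hμ' : IsSMC μ')
    (h : marginals μ = marginals μ') : μ = μ' := by
  have := hμ.1
  have := hμ'.1
  have hfam : IsProjectiveMeasureFamily (fun I : Finset ℕ => μ'.map I.restrict) := by
    intro I J hJI
    rw [Measure.map_map (by fun_prop) (by fun_prop)]
    rfl
  have hl' : IsProjectiveLimit μ' (fun I : Finset ℕ => μ'.map I.restrict) := fun I => rfl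
  have hl : IsProjectiveLimit μ (fun I : Finset ℕ => μ'.map I.restrict) := by
    rw [isProjectiveLimit_nat_iff hfam]
    intro n
    apply Measure.ext_of_singleton
    intro b
    have key : (Preorder.frestrictLe n : Path → _) ⁻¹' {b} =
        {S | ∀ i ≤ n, S i = (fun j => if hj : j ≤ n then b ⟨j, Finset.mem_Iic.2 hj⟩ else 0) i} := by
      ext S
      simp only [Set.mem_preimage, Set.mem_singleton_iff, Set.mem_ofPred_eq]
      constructor
      · rintro rfl i hi
        simp [hi]
      · intro hS
        ext ⟨i, hi⟩
        have := hS i (Finset.mem_Iic.1 hi)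
        rw [dif_pos (Finset.mem_Iic.1 hi)] at this
        exact this
    have e := cyl_eq hμ hμ' h (fun j => if hj : j ≤ n then b ⟨j, Finset.mem_Iic.2 hj⟩ else 0) n
    rw [← key] at e
    rw [Measure.map_apply (by fun_prop) (measurableSet_singleton b)]
    change _ = μ'.map (Preorder.frestrictLe n) {b}
    rw [Measure.map_apply (by fun_prop) (measurableSet_singleton b)]
    exact (ENNReal.toReal_eq_toReal_iff' (measure_ne_top _ _) (measure_ne_top _ _)).1 e
  exact hl.unique hl'

lemma compact_PMC : IsCompact PMC := by
  have hK := isCompact_setOfPred_probabilityMeasure_mass_eq_compl_isCompact_le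
    (E := Path) (u := fun _ => 0) (K := fun _ => staircaseSet) tendsto_const_nhds
    (fun _ => compact_stair) (Or.inr monotone_const)
  have hC : IsClosed {μ : ProbabilityMeasure Path | ∀ (N : ℕ) (a : ℕ → ℕ),
    pr (μ : Measure Path) {S | (∀ i ≤ N, S i = a i) ∧ S (N + 1) = a (N + 1)}
        * pr (μ : Measure Path) {S | S N = a N}
      = pr (μ : Measure Path) {S | S N = a N ∧ S (N + 1) = a (N + 1)}
        * pr (μ : Measure Path) {S | ∀ i ≤ N, S i = a i}} := by
    rw [Set.ofPred_forall]
    refine isClosed_iInter fun N => ?_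
    rw [Set.ofPred_forall]
    refine isClosed_iInter fun a => isClosed_eq ?_ ?_
    · exact (continuous_pr (clopen_cyl' N a)).mul (continuous_pr (clopen_eq _ _))
    · exact (continuous_pr (clopen_pair _ _ _)).mul (continuous_pr (clopen_cyl _ _))
  convert hK.inter_right hC using 1
  ext μ
  have : (μ : Measure Path) staircaseSet = 1 ↔ ∀ n : ℕ, μ staircaseSetᶜ ≤ 0 := by
    rw [← prob_compl_eq_zero_iff compact_stair.measurableSet]
    simp
  constructor
  · intro h
    have h' := smc_cross.1 h
    exact ⟨this.1 h'.2.1, h'.2.2⟩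
  · rintro ⟨h1, h2⟩
    exact smc_cross.2 ⟨inferInstance, this.2 h1, h2⟩

noncomputable def stp (r : ℕ → ℕ → unitInterval) (ω : ℕ → unitInterval) : ℕ → ℕ
  | 0 => 0
  | n + 1 => if ω n < r n (stp r ω n) then stp r ω n else n + 1

noncomputable def PI : Measure (ℕ → unitInterval) :=
  Measure.infinitePi (fun _ : ℕ => (volume : Measure unitInterval))

instance : IsProbabilityMeasure PI := by unfold PI; infer_instance

lemma stp_stair (r : ℕ → ℕ → unitInterval) (ω : ℕ → unitInterval) : stp r ω ∈ staircaseSet := by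
  constructor
  · intro N
    induction N with
    | zero => simp [stp]
    | succ N ih => rw [stp]; split_ifs <;> omega
  · intro N
    rw [stp]
    split_ifs <;> simp

lemma stp_meas (r : ℕ → ℕ → unitInterval) : Measurable (stp r) := by
  rw [measurable_pi_iff]
  intro N
  induction N with
  | zero => exact measurable_const
  | succ N ih =>
    simp only [stp]
    refine Measurable.ite ?_ ih measurable_const
    exact measurableSet_lt (measurable_pi_apply N) ((measurable_of_countable (r N)).comp ih)

lemma stp_congr (r : ℕ → ℕ → unitInterval) {ω ω' : ℕ → unitInterval} (N : ℕ)
    (h : ∀ i < N, ω i = ω' i) : ∀ i ≤ N, stp r ω i = stp r ω' i := by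
  intro i
  induction i with
  | zero => intro _; rfl
  | succ i ih =>
    intro hi
    rw [stp, stp, ih (by omega), h i (by omega)]

lemma indep_step (N : ℕ) {A : Set (ℕ → unitInterval)} (hA : MeasurableSet A)
    (hdep : ∀ ω ω' : ℕ → unitInterval, (∀ i < N, ω i = ω' i) → ω ∈ A → ω' ∈ A)
    {B : Set unitInterval} (hB : MeasurableSet B) :
    PI (A ∩ {ω | ω N ∈ B}) = PI A * volume B := by
  have hi : ProbabilityTheory.iIndepFun (fun (i : ℕ) (ω : ℕ → unitInterval) => ω i) PI :=
    ProbabilityTheory.iIndepFun_infinitePi (P := fun _ : ℕ => (volume : Measure unitInterval))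
      (X := fun _ x => x) (fun _ => measurable_id)
  have h2 := hi.indepFun_finset (Finset.range N) {N} (by simp) (fun i => measurable_pi_apply i)
  let ext : (Finset.range N → unitInterval) → (ℕ → unitInterval) :=
    fun x i => if hi : i ∈ Finset.range N then x ⟨i, hi⟩ else 0
  have hext : Measurable ext := by
    rw [measurable_pi_iff]
    intro i
    by_cases hi : i ∈ Finset.range N
    · simp only [ext, hi, dif_pos]
      exact measurable_pi_apply _
    · simp only [ext, hi]
      exact measurable_const
  have hev : Measurable (fun x : (({N} : Finset ℕ) → unitInterval) => x ⟨N, by simp⟩) :=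
    measurable_pi_apply _
  have h3 := h2.measure_inter_preimage_eq_mul _ _ (hext hA) (hev hB)
  have e1 : (fun (ω : ℕ → unitInterval) (i : Finset.range N) => ω i) ⁻¹' (ext ⁻¹' A) = A := by
    ext ω
    have : ∀ i < N, ext (fun i : Finset.range N => ω i) i = ω i := by
      intro i hi
      simp [ext, hi]
    constructor
    · intro h
      exact hdep _ _ this h
    · intro h
      exact hdep _ _ (fun i hi => (this i hi).symm) h
  have e2 : PI {ω | ω N ∈ B} = volume B := by
    have := (measurePreserving_eval_infinitePi
      (fun _ : ℕ => (volume : Measure unitInterval)) N).measure_preimage hB.nullMeasurableSet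
    exact this
  rw [e1] at h3
  rw [← e2]
  exact h3

def Bset (r : ℕ → ℕ → unitInterval) (N s t : ℕ) : Set unitInterval :=
  {u | (if u < r N s then s else N + 1) = t}

lemma Bset_meas (r : ℕ → ℕ → unitInterval) (N s t : ℕ) : MeasurableSet (Bset r N s t) := by
  have : Measurable fun u : unitInterval => if u < r N s then s else N + 1 :=
    Measurable.ite measurableSet_Iio measurable_const measurable_const
  exact this (measurableSet_singleton t)

noncomputable def law (r : ℕ → ℕ → unitInterval) : Measure Path := PI.map (stp r)

instance (r : ℕ → ℕ → unitInterval) : IsProbabilityMeasure (law r) :=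
  Measure.isProbabilityMeasure_map (stp_meas r).aemeasurable

lemma law_step (r : ℕ → ℕ → unitInterval) (N s t : ℕ) {A : Set Path} (hA : MeasurableSet A)
    (hdep : ∀ S S' : Path, (∀ i ≤ N, S i = S' i) → S ∈ A → S' ∈ A)
    (hs : ∀ S ∈ A, S N = s) :
    pr (law r) (A ∩ {S | S (N + 1) = t}) = pr (law r) A * (volume (Bset r N s t)).toReal := by
  unfold pr law
  rw [Measure.map_apply (stp_meas r) hA,
    Measure.map_apply (stp_meas r) (hA.inter (clopen_eq (N + 1) t).isOpen.measurableSet),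
    ← ENNReal.toReal_mul, ← indep_step N (stp_meas r hA) _ (Bset_meas r N s t)]
  · congr 2
    ext ω
    simp only [Set.mem_preimage, Set.mem_inter_iff, Set.mem_ofPred_eq, Bset]
    refine and_congr_right fun h => ?_
    rw [stp, hs _ h]
  · intro ω ω' h hω
    exact hdep _ _ (stp_congr r N h) hω

lemma law_stair (r : ℕ → ℕ → unitInterval) : law r staircaseSet = 1 := by
  unfold law
  rw [Measure.map_apply (stp_meas r) compact_stair.measurableSet]
  have : stp r ⁻¹' staircaseSet = Set.univ := Set.eq_univ_of_forall (stp_stair r)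
  rw [this, measure_univ]

lemma law_pair (r : ℕ → ℕ → unitInterval) (N s t : ℕ) :
    pr (law r) {S | S N = s ∧ S (N + 1) = t}
      = pr (law r) {S | S N = s} * (volume (Bset r N s t)).toReal :=
  law_step r N s t (clopen_eq N s).isOpen.measurableSet
    (fun S S' h hS => (h N le_rfl).symm.trans hS) (fun S hS => hS)

lemma law_smc (r : ℕ → ℕ → unitInterval) : IsSMC (law r) := by
  refine smc_cross.2 ⟨inferInstance, law_stair r, fun N a => ?_⟩
  rw [law_pair]
  have : pr (law r) {S | (∀ i ≤ N, S i = a i) ∧ S (N + 1) = a (N + 1)} = _ :=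
    law_step r N (a N) (a (N + 1)) (A := {S | ∀ i ≤ N, S i = a i}) (clopen_cyl N a).isOpen.measurableSet
      (fun S S' h hS i hi => (h i hi).symm.trans (hS i hi)) (fun S hS => hS N le_rfl)
  rw [this]
  ring

noncomputable def rr (ν : ℕ → ℕ → ℝ) (N s : ℕ) : unitInterval :=
  Set.projIcc 0 1 zero_le_one (ν (N + 1) s / ν N s)

lemma law_marg {ν : ℕ → ℕ → ℝ} (hν : ν ∈ D) : marginals (law (rr ν)) = ν := by
  obtain ⟨h0, hz, hsum, hmono⟩ := hν
  have hs := ae_stair (law_stair (rr ν))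
  -- the top entry is determined by the others
  have htop : ∀ N, (∀ a < N, marginals (law (rr ν)) N a = ν N a) →
      ∀ a, marginals (law (rr ν)) N a = ν N a := by
    intro N h a
    rcases lt_trichotomy a N with ha | ha | ha
    · exact h a ha
    · subst ha
      have h1 := sum_marg hs a
      have h2 := hsum a
      rw [Finset.sum_range_succ] at h1 h2
      rw [Finset.sum_congr rfl fun i hi => h i (Finset.mem_range.1 hi)] at h1
      linarith
    · rw [marg_zero hs N a ha, hz N a ha]
  have main : ∀ N a, marginals (law (rr ν)) N a = ν N a := by
    intro N
    induction N with
    | zero => exact htop 0 (fun a ha => absurd ha (Nat.not_lt_zero a))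
    | succ N ih =>
      apply htop
      intro a ha
      have ha' : a ≤ N := by omega
      have h1 := pair_eq hs N a a
      simp only [pairF, ha', if_true] at h1
      rw [← h1, law_pair]
      have h2 : pr (law (rr ν)) {S | S N = a} = ν N a := ih a
      have h3 : Bset (rr ν) N a a = Set.Iio (rr ν N a) := by
        ext u
        simp only [Bset, Set.mem_ofPred_eq, Set.mem_Iio]
        split_ifs with h
        · simp [h]
        · simp only [h, iff_false]
          omega
      rw [h2, h3, unitInterval.volume_Iio, ENNReal.toReal_ofReal (rr ν N a).2.1]
      have h4 := h0 N a
      have h5 := h0 (N + 1) a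
      have h6 := hmono N a ha'
      have h7 : ((rr ν N a : unitInterval) : ℝ) = ν (N + 1) a / ν N a := by
        unfold rr
        rw [Set.projIcc_of_mem zero_le_one ⟨div_nonneg h5 h4, div_le_one_of_le₀ h6 h4⟩]
      rw [h7]
      rcases h4.eq_or_lt with h8 | h8
      · rw [← h8]
        have : ν (N + 1) a = 0 := by linarith
        simp [this]
      · field_simp
  funext N a
  exact main N a

noncomputable def phi (μ : PMC) : D :=
  ⟨marginals ((μ : ProbabilityMeasure Path) : Measure Path), marg_mem (ae_stair μ.2.2.1)⟩

lemma phi_cont : Continuous phi := by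
  refine Continuous.subtype_mk ?_ _
  refine continuous_pi fun N => continuous_pi fun a => ?_
  exact (continuous_pr (clopen_eq N a)).comp continuous_subtype_val

lemma phi_bij : Function.Bijective phi := by
  constructor
  · intro μ μ' h
    have h' := smc_ext μ.2 μ'.2 (congrArg Subtype.val h)
    exact Subtype.ext (Subtype.ext h')
  · intro ν
    exact ⟨⟨⟨law (rr ν), inferInstance⟩, law_smc _⟩, Subtype.ext (law_marg ν.2)⟩

/-- The map `Φ` sending a staircase Markov chain to its sequence of
one-dimensional marginals is a homeomorphism from `P_MC(𝒮)` onto `𝒟`, whose inverse sends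
`ν ∈ 𝒟` to the law of the inhomogeneous Markov chain with the indicated transitions. -/
theorem statement0 :
    ∃ e : PMC ≃ₜ D,
      (∀ μ : PMC, (e μ : ℕ → ℕ → ℝ) = marginals ((μ : ProbabilityMeasure Path) : Measure Path)) ∧
      (∀ (ν : D) (μ : PMC), e μ = ν →
        pr ((μ : ProbabilityMeasure Path) : Measure Path) {S | S 0 = 0} = 1 ∧
        ∀ N s : ℕ, s ≤ N → 0 < (ν : ℕ → ℕ → ℝ) N s →
          (pr ((μ : ProbabilityMeasure Path) : Measure Path) {S | S N = s ∧ S (N + 1) = s} /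
              pr ((μ : ProbabilityMeasure Path) : Measure Path) {S | S N = s}
            = (ν : ℕ → ℕ → ℝ) (N + 1) s / (ν : ℕ → ℕ → ℝ) N s) ∧
          (pr ((μ : ProbabilityMeasure Path) : Measure Path) {S | S N = s ∧ S (N + 1) = N + 1} /
              pr ((μ : ProbabilityMeasure Path) : Measure Path) {S | S N = s}
            = 1 - (ν : ℕ → ℕ → ℝ) (N + 1) s / (ν : ℕ → ℕ → ℝ) N s)) := by
  have : CompactSpace PMC := isCompact_iff_compactSpace.1 compact_PMC
  let e0 : PMC ≃ D := Equiv.ofBijective phi phi_bij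
  have hc : Continuous e0 := phi_cont
  refine ⟨hc.homeoOfEquivCompactToT2, fun μ => rfl, ?_⟩
  intro ν μ h
  have hν : (ν : ℕ → ℕ → ℝ) = marginals ((μ : ProbabilityMeasure Path) : Measure Path) := by
    rw [← h]
    rfl
  have hs := ae_stair μ.2.2.1
  refine ⟨?_, ?_⟩
  · have := sum_marg hs 0
    simpa [marginals] using this
  · intro N s hsN hpos
    have hpos' : 0 < pr ((μ : ProbabilityMeasure Path) : Measure Path) {S | S N = s} := by
      rw [hν] at hpos
      exact hpos
    rw [pair_eq hs, pair_eq hs, hν]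
    have hne : ¬ (N + 1 = s) := by omega
    simp only [pairF, hsN, hne, if_true, if_false]
    refine ⟨rfl, ?_⟩
    simp only [marginals]
    rw [sub_div, div_self hpos'.ne']

end VMCPaper
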